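/- arXiv:1611.04198 — 4 statements merged into one kernel-verified Lean document; each statement's English description precedes it below -/
import Mathlib

section
/- Moment relations for low-degree interpolants (Eqs. (1th0)–(1th1)): let λ ∈ ℂ with λ ∉ {κ_1,…,κ_N}, let f_1,…,f_N ∈ ℂ, and suppose there exists a polynomial P ∈ ℂ[X] of degree at most N_b such that P(κ_m) = (λ − κ_m) f_m for every m = 1,…,N and P(λ) = −R(λ). Then for every n = 1,…,N_a one has ∑_{m=1}^{N} f_m κ_m^{n−1} / r_m = −λ^{n−1}. -/
open Finset Matrix Polynomial

noncomputable section

/-- `rProd κ n = ∏_{m ≠ n} (κ n - κ m)`. -/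
def rProd {N : ℕ} (κ : Fin N → ℝ) (n : Fin N) : ℝ :=
  ∏ m ∈ Finset.univ.erase n, (κ n - κ m)

/-- `Rpoly κ z = ∏_{n=1}^N (z - κ n)`. -/
def Rpoly {N : ℕ} (κ : Fin N → ℝ) (z : ℂ) : ℂ :=
  ∏ n, (z - (κ n : ℂ))

/-- Barycentric evaluation formula for a polynomial of degree less than the number
of nodes, away from the nodes. -/
theorem Lagrange.eval_eq_eval_nodal_mul_sum {F ι : Type*} [Field F] [DecidableEq ι]
    {s : Finset ι} {v : ι → F} (hvs : Set.InjOn v s) {Q : F[X]} (hQ : Q.degree < #s)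
    {x : F} (hx : ∀ i ∈ s, x ≠ v i) :
    Q.eval x = (Lagrange.nodal s v).eval x *
      ∑ i ∈ s, Lagrange.nodalWeight s v i * (x - v i)⁻¹ * Q.eval (v i) := by
  rw [← Lagrange.eval_interpolate_not_at_node _ hx, ← Lagrange.eq_interpolate hvs hQ]

/-- Moment relations for low-degree interpolants (Eqs. (1th0)–(1th1)). -/
theorem moment_relations (Na Nb : ℕ) (hNa : 1 ≤ Na) (hNb : 1 ≤ Nb)
    (κ : Fin (Na + Nb) → ℝ) (hκ : StrictMono κ)
    (lam : ℂ) (hlam : ∀ n, lam ≠ (κ n : ℂ))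
    (f : Fin (Na + Nb) → ℂ) (P : Polynomial ℂ)
    (hdeg : P.degree ≤ (Nb : WithBot ℕ))
    (hP : ∀ m, P.eval ((κ m : ℝ) : ℂ) = (lam - (κ m : ℂ)) * f m)
    (hPlam : P.eval lam = - Rpoly κ lam) :
    ∀ n : Fin Na, (∑ m, f m * (κ m : ℂ) ^ (n : ℕ) / (rProd κ m : ℂ)) = - lam ^ (n : ℕ) := by
  intro n
  have hinj : Set.InjOn (fun m => (κ m : ℂ)) (Finset.univ : Finset (Fin (Na + Nb))) :=
    (Complex.ofReal_injective.comp hκ.injective).injOn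
  have hQ : (P * X ^ (n : ℕ)).degree <
      ((#(Finset.univ : Finset (Fin (Na + Nb))) : ℕ) : WithBot ℕ) := by
    rw [degree_mul, degree_X_pow, card_fin]
    calc P.degree + ((n : ℕ) : WithBot ℕ) ≤ (Nb : WithBot ℕ) + ((n : ℕ) : WithBot ℕ) := by gcongr
      _ < ((Na + Nb : ℕ) : WithBot ℕ) := by
        have := n.isLt
        norm_cast
        omega
  have hR : Rpoly κ lam ≠ 0 := Finset.prod_ne_zero_iff.mpr fun m _ => sub_ne_zero.mpr (hlam m)
  have key := Lagrange.eval_eq_eval_nodal_mul_sum hinj hQ fun m _ => hlam m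
  rw [Lagrange.eval_nodal, eval_mul, hPlam, eval_pow, eval_X] at key
  apply mul_left_cancel₀ hR
  rw [mul_neg, ← neg_mul, key, Rpoly]
  congr 1
  refine Finset.sum_congr rfl fun m _ => ?_
  have hm : lam - (κ m : ℂ) ≠ 0 := sub_ne_zero.mpr (hlam m)
  have hw : Lagrange.nodalWeight Finset.univ (fun m => (κ m : ℂ)) m = (rProd κ m : ℂ)⁻¹ := by
    simp [Lagrange.nodalWeight, rProd, Finset.prod_inv_distrib]
  rw [hw, eval_mul, hP, eval_pow, eval_X, div_eq_mul_inv]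
  field_simp

end
end

section
/- Explicit values of the Cauchy–Jost function at the discrete points (Eq. (1th2)): if f is a Cauchy–Jost function for the data (κ, C, C', e), then for every λ ∈ ℂ with λ ∉ {κ_1,…,κ_N} and every m = 1,…,N, f(λ, κ_m) = −∑_{j=1}^{N_a} λ^{j−1} ((C' E^{−1} V')^{−1} C' r E^{−1})_{j,m}. -/
open Finset Matrix Polynomial Filter Topology

noncomputable section

/-- The incomplete Vandermonde matrix `V`, of size `N_b × N`. -/
def Vmat (Na Nb : ℕ) (κ : Fin (Na + Nb) → ℝ) : Matrix (Fin Nb) (Fin (Na + Nb)) ℝ :=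
  Matrix.of fun i n => κ n ^ (i : ℕ)

/-- The incomplete Vandermonde matrix `V'`, of size `N × N_a`. -/
def Vmat' (Na Nb : ℕ) (κ : Fin (Na + Nb) → ℝ) : Matrix (Fin (Na + Nb)) (Fin Na) ℝ :=
  Matrix.of fun n j => κ n ^ (j : ℕ)

/-- `f` is a Cauchy–Jost function for the data `(κ, C, C', e)`:
(i) for every `λ` there is a polynomial `P_λ` of degree at most `N_b` with
`(λ-μ) f(λ,μ) = P_λ(μ)` for all `μ ≠ λ`; (ii) `P_λ(λ) = -R(λ)`;
(iii) `∑_m f(λ,κ_m) e_m C_{m,k} = 0` for `λ ∉ {κ_1,…,κ_N}` and all `k`. -/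
def IsCauchyJost {N Nb : ℕ} (κ : Fin N → ℝ) (C : Matrix (Fin N) (Fin Nb) ℝ)
    (e : Fin N → ℝ) (f : ℂ → ℂ → ℂ) : Prop :=
  (∀ lam : ℂ, ∃ P : Polynomial ℂ, P.degree ≤ (Nb : WithBot ℕ) ∧
      (∀ mu : ℂ, mu ≠ lam → (lam - mu) * f lam mu = P.eval mu) ∧
      P.eval lam = - Rpoly κ lam) ∧
  (∀ lam : ℂ, (∀ n, lam ≠ (κ n : ℂ)) →
      ∀ k : Fin Nb, (∑ m, f lam ((κ m : ℝ) : ℂ) * (e m : ℂ) * (C m k : ℂ)) = 0)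

/-- If `B * A = 0` and the ranks of `A` and `B` add up to the inner dimension, the left kernel of `A`
is contained in the row space of `B`. -/
theorem exists_vecMul_eq_of_vecMul_eq_zero {K l m n : Type*} [Field K] [Fintype l] [Fintype m]
    [Fintype n] (A : Matrix m n K) (B : Matrix l m K) (hBA : B * A = 0)
    (hrank : B.rank + A.rank = Fintype.card m) (v : m → K) (hv : v ᵥ* A = 0) :
    ∃ a : l → K, a ᵥ* B = v := by
  have hle : LinearMap.range B.vecMulLinear ≤ LinearMap.ker A.vecMulLinear := by
    rintro _ ⟨a, rfl⟩
    simp [Matrix.vecMul_vecMul, hBA]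
  have hB : Module.finrank K (LinearMap.range B.vecMulLinear) = B.rank := by
    rw [← Matrix.rank_transpose, Matrix.rank, Matrix.mulVecLin_transpose]
  have hA : Module.finrank K (LinearMap.range A.vecMulLinear) = A.rank := by
    rw [← Matrix.rank_transpose A, Matrix.rank, Matrix.mulVecLin_transpose]
  have hker := LinearMap.finrank_range_add_finrank_ker A.vecMulLinear
  rw [Module.finrank_fintype_fun_eq_card] at hker
  have heq := Submodule.eq_of_le_of_finrank_eq hle (by omega)
  have hmem : v ∈ LinearMap.range B.vecMulLinear := by
    rw [heq]
    simpa using hv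
  simpa using hmem

/-- Complex row vectors in the left kernel of a real matrix are complex combinations of the rows
of a real matrix of complementary rank. -/
theorem exists_complex_vecMul_eq_of_vecMul_eq_zero {l m n : Type*} [Fintype l] [Fintype m]
    [Fintype n] (A : Matrix m n ℝ) (B : Matrix l m ℝ) (hBA : B * A = 0)
    (hrank : B.rank + A.rank = Fintype.card m) (v : m → ℂ)
    (hv : v ᵥ* A.map Complex.ofRealHom = 0) :
    ∃ a : l → ℂ, a ᵥ* B.map Complex.ofRealHom = v := by
  obtain ⟨a, ha⟩ := exists_vecMul_eq_of_vecMul_eq_zero A B hBA hrank (fun i => (v i).re) (by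
    ext k
    simpa [Matrix.vecMul, dotProduct] using congrArg Complex.re (congrFun hv k))
  obtain ⟨b, hb⟩ := exists_vecMul_eq_of_vecMul_eq_zero A B hBA hrank (fun i => (v i).im) (by
    ext k
    simpa [Matrix.vecMul, dotProduct] using congrArg Complex.im (congrFun hv k))
  refine ⟨fun i => ⟨a i, b i⟩, ?_⟩
  ext i
  apply Complex.ext
  · simpa [Matrix.vecMul, dotProduct] using congrFun ha i
  · simpa [Matrix.vecMul, dotProduct] using congrFun hb i

theorem rProd_ne_zero {N : ℕ} {κ : Fin N → ℝ} (hκ : Function.Injective κ) (n : Fin N) :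
    rProd κ n ≠ 0 :=
  Finset.prod_ne_zero_iff.2 fun _ hm =>
    sub_ne_zero.2 fun h => Finset.ne_of_mem_erase hm (hκ h).symm

/-- Lagrange interpolation at the nodes `κ`, in partial fraction form. -/
theorem eval_eq_Rpoly_mul_sum {N : ℕ} {κ : Fin N → ℝ} (hκ : Function.Injective κ)
    (Q : Polynomial ℂ) (hQ : Q.degree < (N : WithBot ℕ)) (z : ℂ) (hz : ∀ n, z ≠ (κ n : ℂ)) :
    Q.eval z = Rpoly κ z *
      ∑ m, ((rProd κ m : ℝ) : ℂ)⁻¹ * (z - (κ m : ℂ))⁻¹ * Q.eval (κ m : ℂ) := by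
  have hinj : Set.InjOn (fun n => (κ n : ℂ)) (Finset.univ : Finset (Fin N)) :=
    (Complex.ofReal_injective.comp hκ).injOn
  have h := Lagrange.eq_interpolate (f := Q) hinj (by simpa using hQ)
  conv_lhs => rw [h]
  rw [Lagrange.eval_interpolate_not_at_node _ (fun i _ => hz i), Lagrange.eval_nodal]
  simp [Rpoly, Lagrange.nodalWeight, rProd, Finset.prod_inv_distrib]

/-- The moments of `f (lam, κ_m) / r_m` against `κ_m ^ j`, for `j < N_a`. -/
theorem IsCauchyJost.sum_mul_pow {Na Nb : ℕ} {κ : Fin (Na + Nb) → ℝ}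
    (hκ : Function.Injective κ) {C : Matrix (Fin (Na + Nb)) (Fin Nb) ℝ}
    {e : Fin (Na + Nb) → ℝ} {f : ℂ → ℂ → ℂ} (hf : IsCauchyJost κ C e f) (lam : ℂ)
    (hlam : ∀ n, lam ≠ (κ n : ℂ)) (j : Fin Na) :
    ∑ m, f lam (κ m : ℂ) * ((rProd κ m : ℝ) : ℂ)⁻¹ * (κ m : ℂ) ^ (j : ℕ) = - lam ^ (j : ℕ) := by
  obtain ⟨P, hdeg, hP, hPlam⟩ := hf.1 lam
  have hR : Rpoly κ lam ≠ 0 := Finset.prod_ne_zero_iff.2 fun n _ => sub_ne_zero.2 (hlam n)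
  have hQ : (P * X ^ (j : ℕ)).degree < ((Na + Nb : ℕ) : WithBot ℕ) := by
    rw [Polynomial.degree_mul, Polynomial.degree_X_pow]
    calc P.degree + ((j : ℕ) : WithBot ℕ) ≤ (Nb : WithBot ℕ) + ((j : ℕ) : WithBot ℕ) := by gcongr
      _ < ((Na + Nb : ℕ) : WithBot ℕ) := by
        have := j.2
        exact_mod_cast (by omega : Nb + (j : ℕ) < Na + Nb)
  have h := eval_eq_Rpoly_mul_sum hκ _ hQ lam hlam
  simp only [Polynomial.eval_mul, Polynomial.eval_pow, Polynomial.eval_X, hPlam] at h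
  apply mul_left_cancel₀ hR
  rw [mul_neg, ← neg_mul, h]
  congr 1
  refine Finset.sum_congr rfl fun m _ => ?_
  rw [← hP _ (hlam m).symm]
  field_simp [sub_ne_zero.2 (hlam m)]

/-- Explicit values of the Cauchy–Jost function at the discrete points (Eq. (1th2)). -/
theorem cauchyJost_values_at_kappa
    (Na Nb : ℕ) (hNa : 1 ≤ Na) (hNb : 1 ≤ Nb)
    (κ : Fin (Na + Nb) → ℝ) (hκ : StrictMono κ)
    (C : Matrix (Fin (Na + Nb)) (Fin Nb) ℝ) (hC : C.rank = Nb)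
    (C' : Matrix (Fin Na) (Fin (Na + Nb)) ℝ) (hC' : C'.rank = Na)
    (horth : C' * Matrix.diagonal (rProd κ) * C = 0)
    (e : Fin (Na + Nb) → ℝ) (he : ∀ n, 0 < e n)
    (hdet : (C' * Matrix.diagonal (fun n => (e n)⁻¹) * Vmat' Na Nb κ).det ≠ 0)
    (f : ℂ → ℂ → ℂ) (hf : IsCauchyJost κ C e f)
    :
    ∀ lam : ℂ, (∀ n, lam ≠ (κ n : ℂ)) → ∀ m : Fin (Na + Nb),
      f lam ((κ m : ℝ) : ℂ) =
        - ∑ j : Fin Na, lam ^ (j : ℕ) *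
            ((((C' * Matrix.diagonal (fun n => (e n)⁻¹) * Vmat' Na Nb κ)⁻¹ * C' *
                Matrix.diagonal (rProd κ) * Matrix.diagonal (fun n => (e n)⁻¹)) j m : ℝ) : ℂ) := by
  intro lam hlam
  have hr := rProd_ne_zero hκ.injective
  have he0 : ∀ n, e n ≠ 0 := fun n => (he n).ne'
  set g : Fin (Na + Nb) → ℂ := fun m => f lam (κ m : ℂ)
  set M := C' * Matrix.diagonal (fun n => (e n)⁻¹) * Vmat' Na Nb κ with hM
  have hrank : (C' * Matrix.diagonal (rProd κ)).rank + C.rank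
      = Fintype.card (Fin (Na + Nb)) := by
    rw [Matrix.rank_mul_eq_left_of_isUnit_det, hC, hC', Fintype.card_fin]
    simpa [Matrix.det_diagonal, Finset.prod_ne_zero_iff] using hr
  obtain ⟨a, ha⟩ := exists_complex_vecMul_eq_of_vecMul_eq_zero C _ horth hrank
    (fun m => g m * (e m : ℂ)) (by
      ext k
      simpa [Matrix.vecMul, dotProduct] using hf.2 lam hlam k)
  have hga : ∀ m, g m * (e m : ℂ) = (∑ i, a i * (C' i m : ℂ)) * (rProd κ m : ℂ) := by
    intro m
    rw [← congrFun ha m]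
    simp [Matrix.vecMul, dotProduct, Finset.sum_mul, mul_assoc]
  have haM : a ᵥ* M.map Complex.ofRealHom = fun j : Fin Na => - lam ^ (j : ℕ) := by
    ext j
    rw [← hf.sum_mul_pow hκ.injective lam hlam j, hM, Matrix.map_mul, ← Matrix.vecMul_vecMul]
    simp only [Matrix.vecMul, dotProduct]
    refine Finset.sum_congr rfl fun m _ => ?_
    have hr' : ((rProd κ m : ℝ) : ℂ) ≠ 0 := by exact_mod_cast hr m
    have he' : (e m : ℂ) ≠ 0 := by exact_mod_cast he0 m
    have hgm : g m * ((rProd κ m : ℝ) : ℂ)⁻¹ = (∑ i, a i * (C' i m : ℂ)) * (e m : ℂ)⁻¹ := by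
      field_simp
      rw [hga m, mul_comm]
    change _ = g m * _ * _
    rw [hgm]
    simp [Vmat', Finset.sum_mul, mul_assoc]
  have hMinv : M * M⁻¹ = 1 := Matrix.mul_nonsing_inv _ (isUnit_iff_ne_zero.2 hdet)
  have haW : a = (fun j : Fin Na => - lam ^ (j : ℕ)) ᵥ* (M⁻¹).map Complex.ofRealHom := by
    rw [← haM, Matrix.vecMul_vecMul, ← Matrix.map_mul, hMinv]
    simp
  have hgB : g = (fun j : Fin Na => - lam ^ (j : ℕ)) ᵥ*
      (M⁻¹ * C' * Matrix.diagonal (rProd κ) * Matrix.diagonal (fun n => (e n)⁻¹)).map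
        Complex.ofRealHom := by
    rw [Matrix.mul_assoc, Matrix.mul_assoc, Matrix.map_mul, ← Matrix.vecMul_vecMul, ← haW,
      ← Matrix.mul_assoc, Matrix.map_mul, ← Matrix.vecMul_vecMul, ha]
    ext m
    have he' : (e m : ℂ) ≠ 0 := by exact_mod_cast he0 m
    simp [Matrix.diagonal_map, Matrix.vecMul_diagonal, he']
  intro m
  change g m = _
  rw [hgB]
  simp [Matrix.vecMul, dotProduct]

end
end

section
/- Second representation of the Cauchy–Jost function (Theorem 1, Eq. (new11)): if f is a Cauchy–Jost function for the data (κ, C, C', e), then det(V E C) ≠ 0 and for every λ ∈ ℂ with λ ∉ {κ_1,…,κ_N} and every μ ∈ ℂ with μ ∉ {λ, κ_1,…,κ_N}, f(λ,μ) = R(λ)/(μ−λ) + R(λ) ∑_{n=1}^{N} (1/(λ−κ_n)) ∑_{j=1}^{N_b} (E C (V E C)^{−1})_{n,j} μ^{j−1}. -/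
open Finset Matrix Polynomial Filter Topology

noncomputable section

/-- If `A * B = 0` and the ranks of `A` and `B` add up to the inner dimension, then every vector in
the left kernel of `B` is a combination of the rows of `A`. -/
theorem exists_vecMul_eq_of_rank_add_rank {K l m n : Type*} [Field K] [Fintype l] [Fintype m]
    [Fintype n] {A : Matrix l m K} {B : Matrix m n K} (hAB : A * B = 0)
    (hrank : A.rank + B.rank = Fintype.card m) {w : m → K} (hw : w ᵥ* B = 0) :
    ∃ u : l → K, u ᵥ* A = w := by
  have hle : LinearMap.range Aᵀ.mulVecLin ≤ LinearMap.ker Bᵀ.mulVecLin := by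
    rintro _ ⟨u, rfl⟩
    simp [Matrix.vecMul_vecMul, hAB]
  have hB := Bᵀ.mulVecLin.finrank_range_add_finrank_ker
  change Bᵀ.rank + _ = _ at hB
  rw [Matrix.rank_transpose, Module.finrank_fintype_fun_eq_card] at hB
  have hA : Module.finrank K (LinearMap.range Aᵀ.mulVecLin) = A.rank := Matrix.rank_transpose A
  have heq := Submodule.eq_of_le_of_finrank_eq hle (by omega)
  have hmem : w ∈ LinearMap.range Aᵀ.mulVecLin := by
    rw [heq]
    simpa [Matrix.mulVec_transpose] using hw
  obtain ⟨u, hu⟩ := hmem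
  exact ⟨u, by simpa [Matrix.mulVec_transpose] using hu⟩

/-- The divided difference of order `N - 1` of a polynomial of degree less than `N - 1` vanishes. -/
theorem sum_eval_div_rProd_eq_zero {N : ℕ} {κ : Fin N → ℝ} (hκ : Function.Injective κ)
    {p : ℝ[X]} (hp : p.natDegree + 1 < N) : ∑ n, p.eval (κ n) / rProd κ n = 0 := by
  have h := Lagrange.coeff_eq_sum (s := Finset.univ) (v := κ) hκ.injOn (P := p)
    (p.degree_le_natDegree.trans_lt (by simp only [card_univ, Fintype.card_fin]; norm_cast; omega))
  rw [Polynomial.coeff_eq_zero_of_natDegree_lt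
    (by simp only [card_univ, Fintype.card_fin]; omega)] at h
  exact h.symm

theorem natDegree_sum_C_mul_X_pow_lt {R : Type*} [Semiring R] {n : ℕ} (hn : 0 < n)
    (v : Fin n → R) : (∑ i : Fin n, Polynomial.C (v i) * X ^ (i : ℕ)).natDegree < n := by
  refine lt_of_le_of_lt (Polynomial.natDegree_sum_le_of_forall_le (n := n - 1) _ _ fun i _ => ?_)
    (by omega)
  exact (Polynomial.natDegree_C_mul_X_pow_le _ _).trans (by omega)

theorem det_Vmat_mul_diagonal_mul_ne_zero
    {Na Nb : ℕ} (hNa : 0 < Na) (hNb : 0 < Nb)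
    {κ : Fin (Na + Nb) → ℝ} (hκ : Function.Injective κ)
    {C : Matrix (Fin (Na + Nb)) (Fin Nb) ℝ} (hC : C.rank = Nb)
    {C' : Matrix (Fin Na) (Fin (Na + Nb)) ℝ} (hC' : C'.rank = Na)
    (horth : C' * Matrix.diagonal (rProd κ) * C = 0)
    {e : Fin (Na + Nb) → ℝ} (he : ∀ n, e n ≠ 0)
    (hdet : (C' * Matrix.diagonal (fun n => (e n)⁻¹) * Vmat' Na Nb κ).det ≠ 0) :
    (Vmat Na Nb κ * Matrix.diagonal e * C).det ≠ 0 := by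
  intro h0
  obtain ⟨v, hv0, hv⟩ := Matrix.exists_vecMul_eq_zero_iff.2 h0
  set q : ℝ[X] := ∑ i : Fin Nb, Polynomial.C (v i) * X ^ (i : ℕ) with hq
  have hqdeg : q.natDegree < Nb := natDegree_sum_C_mul_X_pow_lt hNb v
  have hqV : v ᵥ* Vmat Na Nb κ = fun n => q.eval (κ n) := by
    ext n
    simp [hq, Vmat, Matrix.vecMul, dotProduct, Polynomial.eval_finsetSum]
  have hr := rProd_ne_zero hκ
  have hrank : (C' * Matrix.diagonal (rProd κ)).rank = Na := by
    rw [Matrix.rank_mul_eq_left_of_isUnit_det _ _ (by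
      simpa [Matrix.det_diagonal, Finset.prod_eq_zero_iff] using hr), hC']
  rw [← Matrix.vecMul_vecMul] at hv
  obtain ⟨u, hu⟩ := exists_vecMul_eq_of_rank_add_rank horth (by simp [hrank, hC]) hv
  have hun : ∀ n, (u ᵥ* C') n * rProd κ n = q.eval (κ n) * e n := fun n => by
    have := congrFun hu n
    rwa [← Matrix.vecMul_vecMul, ← Matrix.vecMul_vecMul, Matrix.vecMul_diagonal,
      Matrix.vecMul_diagonal, hqV] at this
  have hu0 : u ᵥ* (C' * Matrix.diagonal (fun n => (e n)⁻¹) * Vmat' Na Nb κ) = 0 := by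
    ext j
    have hsum := sum_eval_div_rProd_eq_zero hκ (p := q * X ^ (j : ℕ)) (by
      have := Polynomial.natDegree_mul_le (p := q) (q := X ^ (j : ℕ))
      rw [Polynomial.natDegree_X_pow] at this
      omega)
    rw [← Matrix.vecMul_vecMul, ← Matrix.vecMul_vecMul, Pi.zero_apply, ← hsum]
    change ∑ n, ((u ᵥ* C') ᵥ* Matrix.diagonal fun n => (e n)⁻¹) n * Vmat' Na Nb κ n j = _
    refine Finset.sum_congr rfl fun n _ => ?_
    rw [Matrix.vecMul_diagonal, Polynomial.eval_mul, Polynomial.eval_pow, Polynomial.eval_X]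
    have h1 := hun n
    have h2 := hr n
    have h3 := he n
    simp only [Vmat', Matrix.of_apply]
    field_simp
    linear_combination κ n ^ (j : ℕ) * h1
  have hu' : u = 0 := by
    by_contra hne
    exact hdet (Matrix.exists_vecMul_eq_zero_iff.1 ⟨u, hne, hu0⟩)
  have hq0 : q = 0 := by
    refine Polynomial.eq_zero_of_natDegree_lt_card_of_eval_eq_zero q hκ (fun n => ?_)
      (by rw [Fintype.card_fin]; omega)
    have := hun n
    rw [hu', Matrix.zero_vecMul, Pi.zero_apply, zero_mul] at this
    exact (mul_eq_zero.1 this.symm).resolve_right (he n)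
  apply hv0
  ext i
  have hc : q.coeff (i : ℕ) = v i := by
    simp [hq, Polynomial.finsetSum_coeff, Polynomial.coeff_X_pow, Fin.val_inj]
  rw [← hc, hq0, Polynomial.coeff_zero, Pi.zero_apply]

/-- At a fixed first argument, a Cauchy–Jost function is its polar part plus a polynomial of degree
less than `Nb`. -/
theorem IsCauchyJost.exists_coeff {N Nb : ℕ} (hNb : 0 < Nb) {κ : Fin N → ℝ}
    {C : Matrix (Fin N) (Fin Nb) ℝ} {e : Fin N → ℝ} {f : ℂ → ℂ → ℂ}
    (hf : IsCauchyJost κ C e f) (lam : ℂ) :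
    ∃ q : Fin Nb → ℂ, ∀ mu, mu ≠ lam →
      f lam mu = Rpoly κ lam / (mu - lam) + ∑ j, q j * mu ^ (j : ℕ) := by
  obtain ⟨P, hdeg, hP, hPlam⟩ := hf.1 lam
  set D := P /ₘ (X - Polynomial.C lam) with hD
  have hDdeg : D.natDegree < Nb := by
    have := Polynomial.natDegree_le_of_degree_le hdeg
    rw [hD, Polynomial.natDegree_divByMonic _ (Polynomial.monic_X_sub_C lam),
      Polynomial.natDegree_X_sub_C]
    omega
  refine ⟨fun j => -D.coeff j, fun mu hmu => ?_⟩
  have hne : mu - lam ≠ 0 := sub_ne_zero.2 hmu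
  have hPmu : P.eval mu = -Rpoly κ lam + (mu - lam) * D.eval mu := by
    conv_lhs => rw [← Polynomial.modByMonic_add_div P (X - Polynomial.C lam),
      Polynomial.modByMonic_X_sub_C_eq_C_eval, hPlam]
    simp [hD]
  have hDmu : ∑ j : Fin Nb, -D.coeff j * mu ^ (j : ℕ) = -D.eval mu := by
    rw [Polynomial.eval_eq_sum_range' hDdeg, Finset.sum_range, ← Finset.sum_neg_distrib]
    simp only [neg_mul]
  rw [hDmu]
  have h := hP mu hmu
  rw [hPmu] at h
  field_simp
  linear_combination -h

/-- Second representation of the Cauchy–Jost function (Theorem 1, Eq. (new11)). -/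
theorem cauchyJost_second_representation
    (Na Nb : ℕ) (hNa : 1 ≤ Na) (hNb : 1 ≤ Nb)
    (κ : Fin (Na + Nb) → ℝ) (hκ : StrictMono κ)
    (C : Matrix (Fin (Na + Nb)) (Fin Nb) ℝ) (hC : C.rank = Nb)
    (C' : Matrix (Fin Na) (Fin (Na + Nb)) ℝ) (hC' : C'.rank = Na)
    (horth : C' * Matrix.diagonal (rProd κ) * C = 0)
    (e : Fin (Na + Nb) → ℝ) (he : ∀ n, 0 < e n)
    (hdet : (C' * Matrix.diagonal (fun n => (e n)⁻¹) * Vmat' Na Nb κ).det ≠ 0)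
    (f : ℂ → ℂ → ℂ) (hf : IsCauchyJost κ C e f)
    :
    (Vmat Na Nb κ * Matrix.diagonal e * C).det ≠ 0 ∧
    ∀ lam : ℂ, (∀ n, lam ≠ (κ n : ℂ)) →
      ∀ mu : ℂ, mu ≠ lam → (∀ n, mu ≠ (κ n : ℂ)) →
        f lam mu =
          Rpoly κ lam / (mu - lam) +
            Rpoly κ lam * ∑ n : Fin (Na + Nb), (1 / (lam - (κ n : ℂ))) *
              ∑ j : Fin Nb,
                (((Matrix.diagonal e * C * (Vmat Na Nb κ * Matrix.diagonal e * C)⁻¹) n j : ℝ) : ℂ) *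
                  mu ^ (j : ℕ) := by
  have hM := det_Vmat_mul_diagonal_mul_ne_zero hNa hNb hκ.injective hC hC' horth
    (fun n => (he n).ne') hdet
  refine ⟨hM, fun lam hlam mu hmu _ => ?_⟩
  obtain ⟨q, hq⟩ := hf.exists_coeff hNb lam
  rw [hq mu hmu]
  congr 1
  set M := Vmat Na Nb κ * Matrix.diagonal e * C with hMdef
  set a : Fin (Na + Nb) → ℂ := fun n => 1 / (lam - (κ n : ℂ)) with ha
  have hqM : q ᵥ* M.map Complex.ofRealHom =
      Rpoly κ lam • (a ᵥ* (Matrix.diagonal e * C).map Complex.ofRealHom) := by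
    ext k
    have hsum : ∑ m, (∑ j : Fin Nb, q j * (κ m : ℂ) ^ (j : ℕ)) * (e m * C m k) =
        Rpoly κ lam * ∑ m, a m * (e m * C m k) := by
      rw [Finset.mul_sum, ← sub_eq_zero, ← Finset.sum_sub_distrib, ← hf.2 lam hlam k]
      refine Finset.sum_congr rfl fun m _ => ?_
      rw [hq _ (hlam m).symm, ha, ← neg_sub lam (κ m : ℂ), div_neg]
      ring
    rw [hMdef, Matrix.mul_assoc, Matrix.map_mul, ← Matrix.vecMul_vecMul]
    simpa [Matrix.vecMul, dotProduct, Vmat, Matrix.diagonal_mul] using hsum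
  have hqG : q = Rpoly κ lam • (a ᵥ* (Matrix.diagonal e * C * M⁻¹).map Complex.ofRealHom) := by
    rw [Matrix.map_mul, ← Matrix.vecMul_vecMul, ← Matrix.smul_vecMul, ← hqM,
      Matrix.vecMul_vecMul, ← Matrix.map_mul, Matrix.mul_nonsing_inv _ (isUnit_iff_ne_zero.2 hM)]
    simp
  rw [hqG]
  simp only [Pi.smul_apply, smul_eq_mul, Matrix.vecMul, dotProduct, Matrix.map_apply,
    Complex.ofRealHom_eq_coe, Finset.mul_sum, Finset.sum_mul]
  rw [Finset.sum_comm]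
  refine Finset.sum_congr rfl fun n _ => Finset.sum_congr rfl fun j _ => ?_
  ring

end
end

section
/- Minor-sum (double Miwa shift) formula for the Cauchy–Jost function (Eqs. (new13), (new15)): if f is a Cauchy–Jost function for the data (κ, C, C', e), then for every λ ∉ {κ_1,…,κ_N} and every μ ∉ {λ, κ_1,…,κ_N}, (μ−λ) f(λ,μ) · det(V E C) = ∑_A C(A) V(A) (∏_{n∈A} e_n (μ−κ_n)) (∏_{n∉A} (λ−κ_n)), where the sum runs over all subsets A = {n_1 < … < n_{N_b}} of {1,…,N} of cardinality N_b, C(A) denotes the determinant of the N_b×N_b submatrix of C formed by the rows n_1,…,n_{N_b}, and V(A) = ∏_{1≤i<j≤N_b} (κ_{n_j} − κ_{n_i}) is the corresponding maximal minor of V. -/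
open Finset Matrix Polynomial Filter Topology

noncomputable section

/-- **Cauchy–Binet formula**. -/
theorem det_mul_eq_sum_minors {R : Type*} [CommRing R] {k N : ℕ}
    (A : Matrix (Fin k) (Fin N) R) (B : Matrix (Fin N) (Fin k) R) :
    (A * B).det = ∑ s : {S : Finset (Fin N) // S.card = k},
      (A.submatrix id (s.1.orderEmbOfFin s.2)).det *
        (B.submatrix (s.1.orderEmbOfFin s.2) id).det := by
  have expand : (A * B).det =
      ∑ g : Fin k → Fin N, (∏ i, A i (g i)) * (B.submatrix g id).det := by
    have hrows : A * B = fun i => ∑ m, A i m • B m := by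
      ext i j
      simp [Matrix.mul_apply, Finset.sum_apply]
    rw [hrows]
    refine (Matrix.detRowAlternating.toMultilinearMap.map_sum
      (fun i m => A i m • B m)).trans (Finset.sum_congr rfl fun g _ => ?_)
    exact Matrix.detRowAlternating.toMultilinearMap.map_smul_univ (fun i => A i (g i))
      fun i => B (g i)
  have zero_of_not_injective : ∀ g : Fin k → Fin N, ¬ Function.Injective g →
      (∏ i, A i (g i)) * (B.submatrix g id).det = 0 := by
    intro g hg
    obtain ⟨i, j, hij, hne⟩ := Function.not_injective_iff.mp hg
    rw [Matrix.det_zero_of_row_eq hne (by ext l; simp [hij]), mul_zero]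
  have minors : ∀ s : {S : Finset (Fin N) // S.card = k},
      (A.submatrix id (s.1.orderEmbOfFin s.2)).det *
        (B.submatrix (s.1.orderEmbOfFin s.2) id).det =
      ∑ σ : Equiv.Perm (Fin k), (∏ i, A i (s.1.orderEmbOfFin s.2 (σ i))) *
        (B.submatrix (s.1.orderEmbOfFin s.2 ∘ σ) id).det := by
    intro s
    rw [← Matrix.det_transpose, Matrix.det_apply', Finset.sum_mul]
    refine Finset.sum_congr rfl fun σ _ => ?_
    have hperm := Matrix.det_permute σ (B.submatrix (s.1.orderEmbOfFin s.2) id)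
    rw [Matrix.submatrix_submatrix, Function.id_comp] at hperm
    rw [hperm]
    simp only [Matrix.transpose_apply, Matrix.submatrix_apply, id_eq]
    ring
  classical
  rw [expand, Finset.sum_congr rfl fun s _ => minors s, ← Finset.sum_product',
    Finset.univ_product_univ,
    ← Finset.sum_filter_of_ne (p := Function.Injective) (fun g _ h => by
      by_contra hg
      exact h (zero_of_not_injective g hg))]
  symm
  refine Finset.sum_bij (fun x _ => x.1.1.orderEmbOfFin x.1.2 ∘ x.2) ?_ ?_ ?_ ?_
  · intro x _
    rw [Finset.mem_filter]
    exact ⟨Finset.mem_univ _, (x.1.1.orderEmbOfFin x.1.2).injective.comp x.2.injective⟩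
  · rintro ⟨⟨S, hS⟩, σ⟩ _ ⟨⟨T, hT⟩, τ⟩ _ h
    dsimp only at h
    have hrange := congrArg Set.range h
    rw [σ.surjective.range_comp, τ.surjective.range_comp, Finset.range_orderEmbOfFin,
      Finset.range_orderEmbOfFin, Finset.coe_inj] at hrange
    subst hrange
    have : σ = τ := Equiv.ext fun i => (S.orderEmbOfFin hS).injective (congrFun h i)
    rw [this]
  · intro g hg
    have hg : Function.Injective g := by simpa using hg
    have hcard : (Finset.univ.image g).card = k := by
      rw [Finset.card_image_of_injective _ hg, Finset.card_univ, Fintype.card_fin]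
    have hmem : ∀ i, ∃ j, (Finset.univ.image g).orderEmbOfFin hcard j = g i := by
      intro i
      rw [← Set.mem_range, Finset.range_orderEmbOfFin]
      simp
    choose τ hτ using hmem
    have hτ_inj : Function.Injective τ := by
      intro i j hij
      apply hg
      rw [← hτ i, ← hτ j, hij]
    exact ⟨⟨⟨_, hcard⟩, Equiv.ofBijective τ (Finite.injective_iff_bijective.mp hτ_inj)⟩,
      Finset.mem_univ _, funext hτ⟩
  · intro x _
    rfl

/-- The determinant of the differences `p i (x j) - p i μ`, where `p i = X ^ i * (X - λ)`. -/
theorem det_pow_mul_sub_sub {K : Type*} [Field K] {k : ℕ} (x : Fin k → K) (lam mu : K) :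
    (Matrix.of fun i j : Fin k =>
        x j ^ (i : ℕ) * (x j - lam) - mu ^ (i : ℕ) * (mu - lam)).det =
      (∏ j, (x j - mu)) * ∏ j : Fin k, ∏ i ∈ Finset.Iio j, (x j - x i) := by
  let p : Fin k → K[X] := fun i => X ^ (i : ℕ) * (X - C lam)
  let q : Fin k → K[X] := fun i => p i /ₘ (X - C mu)
  have hp : ∀ i, (p i).Monic := fun i => (monic_X_pow _).mul (monic_X_sub_C lam)
  have hp_deg : ∀ i, (p i).natDegree = i + 1 := fun i => by
    rw [(monic_X_pow _).natDegree_mul (monic_X_sub_C lam), natDegree_X_pow, natDegree_X_sub_C]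
  have hq_deg : ∀ i, (q i).natDegree = i := fun i => by
    rw [natDegree_divByMonic _ (monic_X_sub_C mu), hp_deg, natDegree_X_sub_C,
      Nat.add_sub_cancel]
  have hq : ∀ i, (q i).Monic := fun i => by
    have hle : (X - C mu).degree ≤ (p i).degree := by
      rw [degree_X_sub_C, degree_eq_natDegree (hp i).ne_zero, hp_deg]
      norm_cast
      omega
    exact (leadingCoeff_divByMonic_of_monic (monic_X_sub_C mu) hle).trans (hp i)
  have hpq : ∀ i y, (p i).eval y - (p i).eval mu = (y - mu) * (q i).eval y := fun i y => by
    have h := congrArg (eval y) (modByMonic_add_div (p i) (X - C mu))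
    rw [modByMonic_X_sub_C_eq_C_eval] at h
    simp only [eval_add, eval_mul, eval_sub, eval_X, eval_C] at h
    linear_combination -h
  have hentries : (Matrix.of fun i j : Fin k =>
        x j ^ (i : ℕ) * (x j - lam) - mu ^ (i : ℕ) * (mu - lam)) =
      Matrix.of fun i j => (x j - mu) * (Matrix.of fun i j => (q j).eval (x i))ᵀ i j := by
    ext i j
    simpa [p] using hpq i (x j)
  rw [hentries, Matrix.det_mul_row, Matrix.det_transpose,
    ← Matrix.det_eval_matrixOfPolynomials_eq_det_vandermonde x q hq_deg hq,
    Matrix.det_vandermonde]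
  congr 1
  exact Finset.prod_comm' fun i j => by simp

/-- If the rows of a matrix `W` and a further row `w` satisfy the linear relation `c W + r w = 0`,
then `(c · u + r) det W` is `r` times the determinant of `W` with the rank-one matrix `u w`
subtracted. -/
theorem mul_det_of_row_relation {R : Type*} [CommRing R] {k : ℕ}
    (W : Matrix (Fin k) (Fin k) R) (u w c : Fin k → R) (r : R)
    (h : ∀ j, ∑ i, c i * W i j + r * w j = 0) :
    (∑ i, c i * u i + r) * W.det = r * (Matrix.of fun i j => W i j - u i * w j).det := by
  let M : Matrix (Fin k ⊕ Unit) (Fin k ⊕ Unit) R :=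
    Matrix.fromBlocks W (Matrix.replicateCol Unit u) (Matrix.replicateRow Unit w) 1
  have hM : M.det = (Matrix.of fun i j => W i j - u i * w j).det := by
    rw [Matrix.det_fromBlocks_one₂₂]
    congr 1
    ext i j
    simp [Matrix.mul_apply]
  have hrow : M.updateRow (Sum.inr ()) (∑ l, Sum.elim c (fun _ => r) l • M l) =
      Matrix.fromBlocks W (Matrix.replicateCol Unit u) 0
        (Matrix.of fun _ _ => ∑ i, c i * u i + r) := by
    ext (i | i) (j | j)
    · simp [M]
    · simp [M]
    · simpa [M, Finset.sum_apply] using h j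
    · simp [M, Finset.sum_apply]
  have hdet := Matrix.det_updateRow_sum M (Sum.inr ()) (Sum.elim c fun _ => r)
  rw [hrow, Matrix.det_fromBlocks_zero₂₁, hM] at hdet
  simpa [mul_comm] using hdet

/-- Minor-sum (double Miwa shift) formula for the Cauchy–Jost function
(Eqs. (new13), (new15)):
`(μ−λ) f(λ,μ) · det(V E C) = ∑_A C(A) V(A) (∏_{n∈A} e_n (μ−κ_n)) (∏_{n∉A} (λ−κ_n))`,
the sum running over all `N_b`-element subsets `A` of `{1,…,N}`. -/
theorem cauchyJost_minor_sum_formula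
    (Na Nb : ℕ) (hNa : 1 ≤ Na) (hNb : 1 ≤ Nb)
    (κ : Fin (Na + Nb) → ℝ) (hκ : StrictMono κ)
    (C : Matrix (Fin (Na + Nb)) (Fin Nb) ℝ) (hC : C.rank = Nb)
    (C' : Matrix (Fin Na) (Fin (Na + Nb)) ℝ) (hC' : C'.rank = Na)
    (horth : C' * Matrix.diagonal (rProd κ) * C = 0)
    (e : Fin (Na + Nb) → ℝ) (he : ∀ n, 0 < e n)
    (hdet : (C' * Matrix.diagonal (fun n => (e n)⁻¹) * Vmat' Na Nb κ).det ≠ 0)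
    (f : ℂ → ℂ → ℂ) (hf : IsCauchyJost κ C e f)
    :
    ∀ lam : ℂ, (∀ n, lam ≠ (κ n : ℂ)) →
      ∀ mu : ℂ, mu ≠ lam → (∀ n, mu ≠ (κ n : ℂ)) →
        (mu - lam) * f lam mu * (((Vmat Na Nb κ * Matrix.diagonal e * C).det : ℝ) : ℂ) =
          ∑ s : {A : Finset (Fin (Na + Nb)) // A.card = Nb},
            (((Matrix.of fun i k : Fin Nb => C (s.1.orderEmbOfFin s.2 i) k).det : ℝ) : ℂ) *
              (∏ j : Fin Nb, ∏ i ∈ Finset.Iio j,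
                (((κ (s.1.orderEmbOfFin s.2 j) : ℝ) : ℂ) - ((κ (s.1.orderEmbOfFin s.2 i) : ℝ) : ℂ))) *
              (∏ n ∈ s.1, ((e n : ℝ) : ℂ) * (mu - (κ n : ℂ))) *
              (∏ n ∈ s.1ᶜ, (lam - (κ n : ℂ))) := by
  intro lam hlam mu hmu _
  obtain ⟨P, hP_deg, hP, hP_lam⟩ := hf.1 lam
  have horth_f := hf.2 lam hlam
  have hsub : ∀ n, (κ n : ℂ) - lam ≠ 0 := fun n => sub_ne_zero.mpr (hlam n).symm
  let p : ℂ[X] := P /ₘ (X - Polynomial.C lam)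
  have hPp : ∀ y, P.eval y = (y - lam) * p.eval y - Rpoly κ lam := fun y => by
    have h := congrArg (eval y) (modByMonic_add_div P (X - Polynomial.C lam))
    rw [modByMonic_X_sub_C_eq_C_eval, hP_lam] at h
    simp only [eval_add, eval_mul, eval_sub, eval_X, eval_C] at h
    linear_combination -h
  have hp_deg : p.natDegree < Nb := by
    rw [natDegree_divByMonic _ (monic_X_sub_C lam), natDegree_X_sub_C]
    have := natDegree_le_of_degree_le hP_deg
    omega
  have hp_eval : ∀ y, p.eval y = ∑ i : Fin Nb, p.coeff i * y ^ (i : ℕ) := fun y => by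
    rw [eval_eq_sum_range' hp_deg, Fin.sum_univ_eq_sum_range (fun i => p.coeff i * y ^ i)]
  have hf_node : ∀ m, f lam (κ m) = -p.eval (κ m : ℂ) + Rpoly κ lam / ((κ m : ℂ) - lam) := by
    intro m
    have h := hP (κ m) (hlam m).symm
    rw [hPp] at h
    have := hsub m
    field_simp
    linear_combination -h
  let W : Matrix (Fin Nb) (Fin Nb) ℂ :=
    Matrix.of fun i k => ∑ m, (κ m : ℂ) ^ (i : ℕ) * (e m : ℂ) * (C m k : ℂ)
  have hW : (((Vmat Na Nb κ * Matrix.diagonal e * C).det : ℝ) : ℂ) = W.det := by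
    rw [← Complex.ofRealHom_eq_coe, RingHom.map_det]
    congr 1
    ext i k
    rw [RingHom.mapMatrix_apply, Matrix.map_apply, Matrix.mul_apply]
    simp only [Matrix.mul_diagonal]
    simp [W, Vmat]
  let w : Fin Nb → ℂ := fun k => ∑ m, (e m : ℂ) * (C m k : ℂ) / ((κ m : ℂ) - lam)
  have hrel : ∀ k, ∑ i : Fin Nb, -p.coeff i * W i k + Rpoly κ lam * w k = 0 := by
    intro k
    rw [← horth_f k]
    simp only [W, w, Matrix.of_apply, Finset.mul_sum]
    rw [Finset.sum_comm, ← Finset.sum_add_distrib]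
    refine Finset.sum_congr rfl fun m _ => ?_
    rw [hf_node, hp_eval, add_mul, add_mul, ← Finset.sum_neg_distrib, Finset.sum_mul,
      Finset.sum_mul]
    congr 1
    · exact Finset.sum_congr rfl fun i _ => by ring
    · ring
  have key := mul_det_of_row_relation W (fun i => mu ^ (i : ℕ) * (mu - lam)) w
    (fun i => -p.coeff i) (Rpoly κ lam) hrel
  have hvalue : (mu - lam) * f lam mu =
      ∑ i : Fin Nb, -p.coeff i * (mu ^ (i : ℕ) * (mu - lam)) + Rpoly κ lam := by
    have h := hP mu hmu
    have hs : ∑ i : Fin Nb, -p.coeff i * (mu ^ (i : ℕ) * (mu - lam)) =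
        -((mu - lam) * p.eval mu) := by
      rw [hp_eval, Finset.mul_sum, ← Finset.sum_neg_distrib]
      exact Finset.sum_congr rfl fun i _ => by ring
    rw [hPp] at h
    rw [hs]
    linear_combination -h
  let G : Matrix (Fin Nb) (Fin (Na + Nb)) ℂ := Matrix.of fun i m =>
    ((e m : ℂ) / ((κ m : ℂ) - lam)) *
      ((κ m : ℂ) ^ (i : ℕ) * ((κ m : ℂ) - lam) - mu ^ (i : ℕ) * (mu - lam))
  have hG : (Matrix.of fun i k => W i k - mu ^ (i : ℕ) * (mu - lam) * w k) =
      G * C.map Complex.ofRealHom := by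
    ext i k
    simp only [W, w, G, Matrix.of_apply, Matrix.mul_apply, Matrix.map_apply, Finset.mul_sum,
      ← Finset.sum_sub_distrib]
    refine Finset.sum_congr rfl fun m _ => ?_
    have := hsub m
    simp only [Complex.ofRealHom_eq_coe]
    field_simp
  rw [hvalue, hW, key, hG, det_mul_eq_sum_minors, Finset.mul_sum]
  refine Finset.sum_congr rfl fun s _ => ?_
  have hCs : ((C.map Complex.ofRealHom).submatrix (s.1.orderEmbOfFin s.2) id).det =
      (((Matrix.of fun i k : Fin Nb => C (s.1.orderEmbOfFin s.2 i) k).det : ℝ) : ℂ) := by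
    rw [← Complex.ofRealHom_eq_coe, RingHom.map_det]
    rfl
  have hprod : ∀ g : Fin (Na + Nb) → ℂ,
      ∏ j : Fin Nb, g (s.1.orderEmbOfFin s.2 j) = ∏ n ∈ s.1, g n := by
    intro g
    conv_rhs => rw [← Finset.image_orderEmbOfFin_univ s.1 s.2]
    rw [Finset.prod_image fun i _ j _ h => (s.1.orderEmbOfFin s.2).injective h]
  have hGs : (G.submatrix id (s.1.orderEmbOfFin s.2)).det =
      (∏ n ∈ s.1, (e n : ℂ) / ((κ n : ℂ) - lam)) * ((∏ n ∈ s.1, ((κ n : ℂ) - mu)) *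
        ∏ j : Fin Nb, ∏ i ∈ Finset.Iio j,
          (((κ (s.1.orderEmbOfFin s.2 j) : ℝ) : ℂ) -
            ((κ (s.1.orderEmbOfFin s.2 i) : ℝ) : ℂ))) := by
    rw [← hprod, ← hprod,
      ← det_pow_mul_sub_sub (fun j => (κ (s.1.orderEmbOfFin s.2 j) : ℂ)) lam mu,
      ← Matrix.det_mul_row]
    rfl
  have hR : Rpoly κ lam * ((∏ n ∈ s.1, (e n : ℂ) / ((κ n : ℂ) - lam)) *
        ∏ n ∈ s.1, ((κ n : ℂ) - mu)) =
      (∏ n ∈ s.1, (e n : ℂ) * (mu - (κ n : ℂ))) * ∏ n ∈ s.1ᶜ, (lam - (κ n : ℂ)) := by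
    rw [Rpoly, ← Finset.prod_mul_prod_compl s.1, ← Finset.prod_mul_distrib, mul_right_comm,
      ← Finset.prod_mul_distrib]
    congr 1
    refine Finset.prod_congr rfl fun n _ => ?_
    have := hsub n
    field_simp
    ring
  rw [hCs, hGs]
  linear_combination (((Matrix.of fun i k : Fin Nb => C (s.1.orderEmbOfFin s.2 i) k).det : ℝ) : ℂ) *
    (∏ j : Fin Nb, ∏ i ∈ Finset.Iio j,
      (((κ (s.1.orderEmbOfFin s.2 j) : ℝ) : ℂ) -
        ((κ (s.1.orderEmbOfFin s.2 i) : ℝ) : ℂ))) * hR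

end
end
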